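/- arXiv:2001.00685 — 3 statements merged into one kernel-verified Lean document; each statement's English description precedes it below -/
import Mathlib

section
/- (Per-step descent inequality.) Let x̂, x* ∈ X, n ∈ ℝ², and γ > 0. Set x̂⁺ := P_X(x̂ + (1/γ)(∇U(x̂) + n)) and Δ := ∇V(x̂) − ∇U(x̂). Then V(x*) − V(x̂⁺) ≤ (L/2 − γ)·‖x̂⁺ − x̂‖² − (μ/2)·‖x* − x̂‖² + γ·⟨x̂⁺ − x̂, x* − x̂⟩ + ⟨Δ, x* − x̂⁺⟩ − ⟨n, x* − x̂⁺⟩. -/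
open scoped InnerProductSpace

local notation "E2" => EuclideanSpace ℝ (Fin 2)

theorem descent_aux (L : ℝ) (V : E2 → ℝ) (g : E2 → E2)
    (hV : ∀ x : E2, HasGradientAt V (g x) x)
    (hs : ∀ x y : E2, ‖g x - g y‖ ≤ L * ‖x - y‖) (x d : E2) :
    V x + ⟪g x, d⟫_ℝ - L / 2 * ‖d‖ ^ 2 ≤ V (x + d) := by
  have hder : ∀ t : ℝ, HasDerivAt
      (fun t : ℝ => V (x + t • d) - t * ⟪g x, d⟫_ℝ + L / 2 * ‖d‖ ^ 2 * t ^ 2)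
      (⟪g (x + t • d), d⟫_ℝ - ⟪g x, d⟫_ℝ + L * ‖d‖ ^ 2 * t) t := by
    intro t
    have h1 : HasDerivAt (fun t : ℝ => x + t • d) d t := by
      simpa using ((hasDerivAt_id t).smul_const d).const_add x
    have h2 := (hV (x + t • d)).hasFDerivAt.comp_hasDerivAt t h1
    have h3 := (h2.sub ((hasDerivAt_id t).mul_const ⟪g x, d⟫_ℝ)).add
      ((hasDerivAt_pow 2 t).const_mul (L / 2 * ‖d‖ ^ 2))
    refine h3.congr_deriv ?_
    simp
    ring
  have hm : MonotoneOn
      (fun t : ℝ => V (x + t • d) - t * ⟪g x, d⟫_ℝ + L / 2 * ‖d‖ ^ 2 * t ^ 2)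
      (Set.Ici 0) := by
    apply monotoneOn_of_deriv_nonneg (convex_Ici 0)
    · exact fun t _ => (hder t).continuousAt.continuousWithinAt
    · exact fun t _ => (hder t).differentiableAt.differentiableWithinAt
    · intro t ht
      have ht : 0 < t := by simpa using ht
      rw [(hder t).deriv]
      have h1 := hs (x + t • d) x
      rw [add_sub_cancel_left, norm_smul, Real.norm_of_nonneg ht.le] at h1
      have h2 := (abs_le.1 (abs_real_inner_le_norm (g (x + t • d) - g x) d)).1
      rw [inner_sub_left] at h2
      nlinarith [mul_le_mul_of_nonneg_right h1 (norm_nonneg d)]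
  have := hm (Set.mem_Ici.2 le_rfl) (Set.mem_Ici.2 zero_le_one) zero_le_one
  simp at this
  linarith

/-- Per-step descent inequality for the inexact projected gradient step. -/
theorem ioga_per_step_descent
    (μ L : ℝ) (hμ : 0 < μ) (hμL : μ ≤ L)
    (X : Set E2) (hXne : X.Nonempty) (hXcl : IsClosed X) (hXcv : Convex ℝ X)
    (PX : E2 → E2)
    (hPX : ∀ z : E2, PX z ∈ X ∧ ∀ y ∈ X, dist (PX z) z ≤ dist y z)
    (V U : E2 → ℝ) (gradV gradU : E2 → E2)
    (hVdiff : ∀ x : E2, HasGradientAt V (gradV x) x)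
    (hUdiff : ∀ x : E2, HasGradientAt U (gradU x) x)
    (hVconc : ∀ x y : E2, V y ≤ V x + ⟪gradV x, y - x⟫_ℝ - μ / 2 * ‖y - x‖ ^ 2)
    (hVsmooth : ∀ x y : E2, ‖gradV x - gradV y‖ ≤ L * ‖x - y‖)
    (xh xs : E2) (hxh : xh ∈ X) (hxs : xs ∈ X)
    (n : E2) (γ : ℝ) (hγ : 0 < γ)
    (xp : E2) (hxp : xp = PX (xh + (1 / γ) • (gradU xh + n))) :
    V xs - V xp
      ≤ (L / 2 - γ) * ‖xp - xh‖ ^ 2 - μ / 2 * ‖xs - xh‖ ^ 2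
        + γ * ⟪xp - xh, xs - xh⟫_ℝ
        + ⟪gradV xh - gradU xh, xs - xp⟫_ℝ
        - ⟪n, xs - xp⟫_ℝ := by
  have hz := hPX (xh + (1 / γ) • (gradU xh + n))
  rw [← hxp] at hz
  obtain ⟨hpX, hmin⟩ := hz
  have hproj : ⟪xh + (1 / γ) • (gradU xh + n) - xp, xs - xp⟫_ℝ ≤ 0 := by
    refine (norm_eq_iInf_iff_real_inner_le_zero hXcv hpX).1 ?_ xs hxs
    have : Nonempty X := ⟨⟨xp, hpX⟩⟩
    apply le_antisymm
    · refine le_ciInf fun w => ?_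
      have := hmin w w.2
      rwa [dist_comm, dist_comm (w : E2), dist_eq_norm, dist_eq_norm] at this
    · exact ciInf_le (f := fun w : X => ‖xh + (1 / γ) • (gradU xh + n) - w‖)
        ⟨0, by rintro _ ⟨w, rfl⟩; exact norm_nonneg _⟩ ⟨xp, hpX⟩
  have hd := descent_aux L V gradV hVdiff hVsmooth xh (xp - xh)
  rw [add_sub_cancel] at hd
  have hc := hVconc xh xs
  have e1 : xh + (1 / γ) • (gradU xh + n) - xp
      = (1 / γ) • ((gradU xh + n) - γ • (xp - xh)) := by
    rw [smul_sub, smul_smul, one_div_mul_cancel hγ.ne', one_smul]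
    abel
  rw [e1, real_inner_smul_left] at hproj
  have hp2 : ⟪(gradU xh + n) - γ • (xp - xh), xs - xp⟫_ℝ ≤ 0 := by
    by_contra h
    push Not at h
    have := mul_pos (one_div_pos.2 hγ) h
    linarith
  have e2 : xs - xp = (xs - xh) - (xp - xh) := by abel
  rw [e2] at hp2 ⊢
  simp only [inner_sub_left (gradU xh + n), inner_sub_left (gradV xh), inner_add_left,
    real_inner_smul_left, inner_sub_right _ (xs - xh) (xp - xh),
    real_inner_self_eq_norm_sq] at hp2 ⊢
  linarith
end

section
/- (Linear lower bound on the offline dynamic regret.) Let T ≥ 1 be an integer and W > 0. For any sequence x : {1,…,T} → ℝ of online decisions, define the adversarial parameters w(t) := −W if x(t) ≥ 0 and w(t) := W otherwise, and the utilities U_t(z) := −(1/2)(z − w(t))². Then: (i) |w(t)| ≤ W for every t, and (w(t+1) − w(t))² ≤ 4W² for 1 ≤ t ≤ T−1, so the comparator sequence x*(t) = w(t) is feasible for the coupling constraint g(z, z') = (z − z')² − 4W² ≤ 0; and (ii) the offline dynamic regret satisfies ∑_{t=1}^{T} (U_t(w(t)) − U_t(x(t))) = (1/2)·∑_{t=1}^{T}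 (x(t) − w(t))² ≥ (W²/2)·T. -/
/-- Linear lower bound on the offline dynamic regret against the sign-flipping adversary. -/
theorem regret_linear_lower_bound
    (T : ℕ) (hT : 1 ≤ T) (W : ℝ) (hW : 0 < W)
    (x : ℕ → ℝ) (w : ℕ → ℝ)
    (hw : ∀ t, w t = if 0 ≤ x t then -W else W)
    (U : ℕ → ℝ → ℝ)
    (hU : ∀ t z, U t z = -(1 / 2) * (z - w t) ^ 2) :
    (∀ t, |w t| ≤ W) ∧
    (∀ t ∈ Finset.Icc 1 (T - 1), (w (t + 1) - w t) ^ 2 ≤ 4 * W ^ 2) ∧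
    (∀ t ∈ Finset.Icc 1 (T - 1), (w (t + 1) - w t) ^ 2 - 4 * W ^ 2 ≤ 0) ∧
    (∑ t ∈ Finset.Icc 1 T, (U t (w t) - U t (x t))
      = 1 / 2 * ∑ t ∈ Finset.Icc 1 T, (x t - w t) ^ 2) ∧
    (1 / 2 * ∑ t ∈ Finset.Icc 1 T, (x t - w t) ^ 2 ≥ W ^ 2 / 2 * T) := by
  have h1 : ∀ t, |w t| ≤ W := by
    intro t
    rw [hw t]
    split_ifs
    · rw [abs_neg, abs_of_pos hW]
    · rw [abs_of_pos hW]
  have h2 : ∀ t, (w (t + 1) - w t) ^ 2 ≤ 4 * W ^ 2 := by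
    intro t
    have a := abs_le.1 (h1 t)
    have b := abs_le.1 (h1 (t + 1))
    nlinarith [a.1, a.2, b.1, b.2]
  have h3 : ∀ t, W ^ 2 ≤ (x t - w t) ^ 2 := by
    intro t
    rw [hw t]
    split_ifs with h
    · nlinarith
    · push Not at h
      nlinarith
  refine ⟨h1, fun t _ => h2 t, fun t _ => sub_nonpos.2 (h2 t), ?_, ?_⟩
  · rw [Finset.mul_sum]
    refine Finset.sum_congr rfl fun t _ => ?_
    rw [hU, hU]
    ring
  · have h := Finset.card_nsmul_le_sum (Finset.Icc 1 T) (fun t => (x t - w t) ^ 2) (W ^ 2)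
      (fun t _ => h3 t)
    simp only [Nat.card_Icc, Nat.add_sub_cancel, nsmul_eq_mul] at h
    linarith
end

section
/- (Gradient formula for the Huber-type utility.) Let v > 0, μ ∈ [0,1], and ℓ ∈ ℝ². Define h : ℝ → ℝ by h(d) = d²/2 for d ≤ v and h(d) = v(1 − μ)·d + (μ/2)·d² − (1 − μ)·v²/2 for d > v (the additive constant is chosen so that h is continuous at d = v), and define F : ℝ² → ℝ by F(x) = h(‖x − ℓ‖). Let P_B denote the metric projection onto the closed ball B = {w ∈ ℝ² : ‖w‖ ≤ v} centered at the origin. Then F is differentiable at every x ∈ ℝ² and its gradient is ∇F(x) = μ·(x − ℓ) + (1 − μ)·P_B(x − ℓ); equivalently, the gradient of U = −F is ∇U(x) = μ·(ℓ − x) + (1 − μ)·P_B(ℓ − x). -/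
local notation "E2" => EuclideanSpace ℝ (Fin 2)


/-- scalar Huber function -/
noncomputable def hubG (v a : ℝ) : ℝ := if a ≤ v then a ^ 2 / 2 else v * a - v ^ 2 / 2

lemma hubG_lower (v a s : ℝ) (hs : s ≤ v) : s * a - s ^ 2 / 2 ≤ hubG v a := by
  unfold hubG
  split_ifs with h
  · nlinarith [sq_nonneg (s - a)]
  · push Not at h
    nlinarith [mul_nonneg (sub_nonneg.2 hs) (sub_nonneg.2 h.le), sq_nonneg (v - s)]

lemma hubG_upper (v a b t : ℝ) (hv : 0 < v) (ha : 0 ≤ a) (hb : 0 ≤ b) (ht : 0 ≤ t)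
    (h : a ≤ t + b) : hubG v a ≤ t ^ 2 / 2 + v * b := by
  unfold hubG
  split_ifs with h1
  · rcases le_total a t with h2 | h2
    · nlinarith [mul_nonneg hv.le hb]
    · nlinarith [mul_nonneg hv.le (sub_nonneg.2 h), mul_nonneg (sub_nonneg.2 h2) (by linarith : 0 ≤ v - (a + t) / 2)]
  · nlinarith [mul_nonneg hv.le (sub_nonneg.2 h), sq_nonneg (t - v)]

lemma proj_formula (v : ℝ) (hv : 0 < v) (z p : E2) (hp : ‖p‖ ≤ v)
    (hmin : ∀ y ∈ Metric.closedBall (0 : E2) v, dist p z ≤ dist y z) :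
    p = if ‖z‖ ≤ v then z else (v / ‖z‖) • z := by
  split_ifs with h
  · have := hmin z (by simpa using h)
    rw [dist_self] at this
    exact dist_le_zero.1 this
  · push Not at h
    have hz : 0 < ‖z‖ := hv.trans h
    set c := v / ‖z‖ with hc
    have hcz : c * ‖z‖ = v := by rw [hc]; field_simp
    have hc0 : 0 < c := by positivity
    have hc1 : c ≤ 1 := by rw [hc, div_le_one hz]; exact h.le
    have h1 := hmin (c • z) (by
      rw [mem_closedBall_zero_iff, norm_smul, Real.norm_of_nonneg hc0.le, hcz])
    rw [dist_eq_norm, dist_eq_norm] at h1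
    have h2 : ‖c • z - z‖ = ‖z‖ - v := by
      have : c • z - z = -((1 - c) • z) := by module
      rw [this, norm_neg, norm_smul, Real.norm_of_nonneg (by linarith)]
      linarith
    rw [h2] at h1
    have h3 : ‖p - z‖ ^ 2 ≤ (‖z‖ - v) ^ 2 := by gcongr
    rw [norm_sub_sq_real] at h3
    have h4 : ‖p - c • z‖ ^ 2 ≤ 0 := by
      rw [norm_sub_sq_real, norm_smul, Real.norm_of_nonneg hc0.le, hcz, real_inner_smul_right]
      have h5 : ‖p‖ ^ 2 ≤ v ^ 2 := by gcongr
      have h6 := mul_le_mul_of_nonneg_left h3 hc0.le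
      have h7 := mul_le_mul_of_nonneg_left h5 (sub_nonneg.2 hc1)
      have h8 : c * (2 * ‖z‖ * v) = 2 * v ^ 2 := by
        rw [← hcz]; ring_nf
      nlinarith
    have h9 : ‖p - c • z‖ = 0 := by
      have := sq_nonneg ‖p - c • z‖
      exact pow_eq_zero_iff (two_ne_zero) |>.1 (le_antisymm h4 this)
    exact sub_eq_zero.1 (norm_eq_zero.1 h9)

lemma proj_eq1 (v : ℝ) (hv : 0 < v) (z p : E2)
    (hp : p = if ‖z‖ ≤ v then z else (v / ‖z‖) • z) :
    hubG v ‖z‖ = inner ℝ p z - ‖p‖ ^ 2 / 2 := by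
  subst hp
  unfold hubG
  split_ifs with h
  · rw [real_inner_self_eq_norm_sq]; ring
  · push Not at h
    have hz : 0 < ‖z‖ := hv.trans h
    rw [real_inner_smul_left, real_inner_self_eq_norm_sq, norm_smul,
      Real.norm_of_nonneg (by positivity)]
    field_simp

lemma proj_eq2 (v : ℝ) (hv : 0 < v) (z p : E2)
    (hp : p = if ‖z‖ ≤ v then z else (v / ‖z‖) • z) :
    hubG v ‖z‖ = ‖p‖ ^ 2 / 2 + v * ‖z - p‖ := by
  subst hp
  unfold hubG
  split_ifs with h
  · simp
  · push Not at h
    have hz : 0 < ‖z‖ := hv.trans h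
    have : z - (v / ‖z‖) • z = (1 - v / ‖z‖) • z := by module
    have h1 : v / ‖z‖ ≤ 1 := by rw [div_le_one hz]; exact h.le
    rw [this, norm_smul, norm_smul, Real.norm_of_nonneg (by positivity),
      Real.norm_of_nonneg (by linarith)]
    field_simp
    ring

/-- Gradient formula for the Huber-type utility. -/
theorem huber_gradient_formula
    (v : ℝ) (hv : 0 < v) (μ : ℝ) (hμ0 : 0 ≤ μ) (hμ1 : μ ≤ 1)
    (ℓ : E2)
    (h : ℝ → ℝ)
    (hh : ∀ d : ℝ, h d = if d ≤ v then d ^ 2 / 2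
      else v * (1 - μ) * d + μ / 2 * d ^ 2 - (1 - μ) * v ^ 2 / 2)
    (F : E2 → ℝ) (hF : ∀ x : E2, F x = h ‖x - ℓ‖)
    (PB : E2 → E2)
    (hPB : ∀ z : E2, PB z ∈ Metric.closedBall (0 : E2) v ∧
      ∀ y ∈ Metric.closedBall (0 : E2) v, dist (PB z) z ≤ dist y z) :
    (∀ x : E2, HasGradientAt F (μ • (x - ℓ) + (1 - μ) • PB (x - ℓ)) x) ∧
    (∀ x : E2, HasGradientAt (fun y : E2 => -F y)
      (μ • (ℓ - x) + (1 - μ) • PB (ℓ - x)) x) := by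
  have hP : ∀ z, PB z = if ‖z‖ ≤ v then z else (v / ‖z‖) • z := fun z =>
    proj_formula v hv z (PB z) (by simpa using (hPB z).1) (hPB z).2
  have hPv : ∀ z, ‖PB z‖ ≤ v := fun z => by simpa using (hPB z).1
  have hneg : ∀ z, PB (-z) = -PB z := by
    intro z
    rw [hP, hP, norm_neg]
    split_ifs <;> simp
  have hFG : ∀ x, F x = μ / 2 * ‖x - ℓ‖ ^ 2 + (1 - μ) * hubG v ‖x - ℓ‖ := by
    intro x
    rw [hF, hh]
    unfold hubG
    split_ifs <;> ring
  have key : ∀ x : E2, HasGradientAt F (μ • (x - ℓ) + (1 - μ) • PB (x - ℓ)) x := by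
    intro x
    rw [hasGradientAt_iff_isLittleO]
    have hO : (fun y : E2 => F y - F x - inner ℝ (μ • (x - ℓ) + (1 - μ) • PB (x - ℓ)) (y - x))
        =O[nhds x] fun y => ‖y - x‖ ^ 2 := by
      refine Asymptotics.IsBigO.of_bound 1 (Filter.Eventually.of_forall fun y => ?_)
      set z := x - ℓ with hz
      set w := y - x with hw
      have hy : y - ℓ = z + w := by rw [hz, hw]; abel
      set p := PB z with hp
      have e1 := proj_eq1 v hv z p (hP z)
      have e2 := proj_eq2 v hv z p (hP z)
      have l1 := hubG_lower v ‖z + w‖ ‖p‖ (hPv z)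
      have l2 := real_inner_le_norm p (z + w)
      have u1 := hubG_upper v ‖z + w‖ ‖z - p‖ ‖p + w‖ hv (norm_nonneg _) (norm_nonneg _)
        (norm_nonneg _) (by
          have : z + w = (p + w) + (z - p) := by abel
          rw [this]; exact norm_add_le _ _)
      rw [norm_add_sq_real] at u1
      rw [inner_add_right] at l2
      have a1 : 0 ≤ hubG v ‖z + w‖ - hubG v ‖z‖ - inner ℝ p w := by linarith
      have a2 : hubG v ‖z + w‖ - hubG v ‖z‖ - inner ℝ p w ≤ ‖w‖ ^ 2 / 2 := by linarith
      have e : F y - F x - inner ℝ (μ • z + (1 - μ) • p) w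
          = μ * (‖w‖ ^ 2 / 2) + (1 - μ) * (hubG v ‖z + w‖ - hubG v ‖z‖ - inner ℝ p w) := by
        rw [hFG, hFG, hy, ← hz, norm_add_sq_real, inner_add_left, real_inner_smul_left,
          real_inner_smul_left]
        ring
      have b1 := mul_nonneg (sub_nonneg.2 hμ1) a1
      have b2 := mul_le_mul_of_nonneg_left a2 (sub_nonneg.2 hμ1)
      have b3 : 0 ≤ μ * (‖w‖ ^ 2 / 2) := by positivity
      have b4 := sq_nonneg ‖w‖
      rw [e, Real.norm_of_nonneg (by linarith), Real.norm_of_nonneg b4]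
      linarith
    refine hO.trans_isLittleO ?_
    have := Asymptotics.isLittleO_pow_sub_sub x (one_lt_two)
    exact this
  refine ⟨key, fun x => ?_⟩
  have h1 := (key x).hasFDerivAt.neg
  have h2 : μ • (ℓ - x) + (1 - μ) • PB (ℓ - x) = -(μ • (x - ℓ) + (1 - μ) • PB (x - ℓ)) := by
    rw [← neg_sub x ℓ, hneg]; module
  rw [h2, hasGradientAt_iff_hasFDerivAt, map_neg]
  exact h1
end
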